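/- arXiv:1909.04852 — 5 statements merged into one kernel-verified Lean document; each statement's English description precedes it below -/
import Mathlib

section
/- Let q and p be independent real random variables, each with the standard normal distribution N(0,1). Then the random variables q/p and q² + p² are independent. -/
open MeasureTheory ProbabilityTheory

theorem gaussianPDF_mul_cos_mul_gaussianPDF_mul_sin (r θ : ℝ) :
    gaussianPDF 0 1 (r * Real.cos θ) * gaussianPDF 0 1 (r * Real.sin θ) =
      gaussianPDF 0 1 r * gaussianPDF 0 1 0 := by
  simp only [gaussianPDF]
  rw [← ENNReal.ofReal_mul (gaussianPDFReal_nonneg _ _ _),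
    ← ENNReal.ofReal_mul (gaussianPDFReal_nonneg _ _ _)]
  congr 1
  simp only [gaussianPDFReal]
  rw [mul_mul_mul_comm, mul_mul_mul_comm _ (Real.exp (-(r - 0) ^ 2 / _)),
    ← Real.exp_add, ← Real.exp_add]
  congr 2
  push_cast
  linear_combination (-r ^ 2 / 2) * Real.sin_sq_add_cos_sq θ

open scoped ENNReal in
/-- Under the standard Gaussian measure on the plane, the integral of a product of a function of
the ratio of the coordinates and a function of their sum of squares factors into an angular part
and a radial part. -/
theorem lintegral_ratio_mul_sumSq_gaussianReal_prod {g h : ℝ → ℝ≥0∞} (hg : Measurable g)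
    (hh : Measurable h) :
    ∫⁻ z, g (z.1 / z.2) * h (z.1 ^ 2 + z.2 ^ 2) ∂(gaussianReal 0 1).prod (gaussianReal 0 1) =
      (∫⁻ r in Set.Ioi 0,
        ENNReal.ofReal r * (gaussianPDF 0 1 r * gaussianPDF 0 1 0) * h (r ^ 2)) *
      ∫⁻ θ in Set.Ioo (-Real.pi) Real.pi, g (Real.cos θ / Real.sin θ) := by
  have hφ : Measurable (gaussianPDF 0 1) := measurable_gaussianPDF 0 1
  rw [gaussianReal_of_var_ne_zero 0 one_ne_zero, prod_withDensity hφ hφ,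
    lintegral_withDensity_eq_lintegral_mul _ (by fun_prop) (by fun_prop),
    ← Measure.volume_eq_prod, ← lintegral_comp_polarCoord_symm,
    ← lintegral_prod_mul (by fun_prop) (by fun_prop), Measure.prod_restrict,
    ← Measure.volume_eq_prod]
  refine setLIntegral_congr_fun (measurableSet_Ioi.prod measurableSet_Ioo) ?_
  rintro ⟨r, θ⟩ ⟨hr, -⟩
  have hratio : r * Real.cos θ / (r * Real.sin θ) = Real.cos θ / Real.sin θ :=
    mul_div_mul_left _ _ (ne_of_gt hr)
  have hsq : (r * Real.cos θ) ^ 2 + (r * Real.sin θ) ^ 2 = r ^ 2 := by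
    linear_combination r ^ 2 * Real.sin_sq_add_cos_sq θ
  simp only [polarCoord_symm_apply, Pi.mul_apply, smul_eq_mul, hratio, hsq,
    gaussianPDF_mul_cos_mul_gaussianPDF_mul_sin]
  ring

theorem indepFun_ratio_sumSq_gaussianReal_prod :
    IndepFun (fun z : ℝ × ℝ => z.1 / z.2) (fun z : ℝ × ℝ => z.1 ^ 2 + z.2 ^ 2)
      ((gaussianReal 0 1).prod (gaussianReal 0 1)) := by
  rw [indepFun_iff_measure_inter_preimage_eq_mul]
  intro s t hs ht
  have hX : Measurable fun z : ℝ × ℝ => z.1 / z.2 := by fun_prop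
  have hY : Measurable fun z : ℝ × ℝ => z.1 ^ 2 + z.2 ^ 2 := by fun_prop
  have key : ∀ s t : Set ℝ, MeasurableSet s → MeasurableSet t → _ := fun s t hs ht =>
    lintegral_ratio_mul_sumSq_gaussianReal_prod
      (measurable_one.indicator hs) (measurable_one.indicator ht)
  have hmeas : ∀ s t : Set ℝ, MeasurableSet s → MeasurableSet t →
      ∫⁻ z : ℝ × ℝ, s.indicator 1 (z.1 / z.2) * t.indicator 1 (z.1 ^ 2 + z.2 ^ 2)
        ∂(gaussianReal 0 1).prod (gaussianReal 0 1) =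
      ((gaussianReal 0 1).prod (gaussianReal 0 1))
        ((fun z : ℝ × ℝ => z.1 / z.2) ⁻¹' s ∩ (fun z : ℝ × ℝ => z.1 ^ 2 + z.2 ^ 2) ⁻¹' t) := by
    intro s t hs ht
    rw [← lintegral_indicator_one ((hX hs).inter (hY ht)), Set.inter_indicator_one]
    rfl
  have h_st := (hmeas s t hs ht).symm.trans (key s t hs ht)
  have hs' := (hmeas s .univ hs .univ).symm.trans (key s .univ hs .univ)
  have ht' := (hmeas .univ t .univ ht).symm.trans (key .univ t .univ ht)
  have h_univ := (hmeas .univ .univ .univ .univ).symm.trans (key .univ .univ .univ .univ)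
  rw [Set.preimage_univ, Set.inter_univ] at hs'
  rw [Set.preimage_univ, Set.univ_inter] at ht'
  rw [Set.preimage_univ, Set.preimage_univ, Set.univ_inter, measure_univ] at h_univ
  rw [h_st, hs', ht']
  rw [← one_mul (lintegral _ _ * _), h_univ]
  ring

/-- If `q` and `p` are independent standard normal random variables, then `q / p` and
`q ^ 2 + p ^ 2` are independent. -/
theorem independent_ratio_sumSq {Ω : Type*} [MeasurableSpace Ω] (μ : Measure Ω)
    [IsProbabilityMeasure μ] (q p : Ω → ℝ) (hq : Measurable q) (hp : Measurable p)
    (hindep : IndepFun q p μ)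
    (hq_law : μ.map q = gaussianReal 0 1) (hp_law : μ.map p = gaussianReal 0 1) :
    IndepFun (fun ω => q ω / p ω) (fun ω => q ω ^ 2 + p ω ^ 2) μ := by
  have hlaw : μ.map (fun ω => (q ω, p ω)) = (gaussianReal 0 1).prod (gaussianReal 0 1) := by
    rw [hindep.map_prod_eq_prod_map_map hq.aemeasurable hp.aemeasurable, hq_law, hp_law]
  have hindep_law := indepFun_ratio_sumSq_gaussianReal_prod
  rw [indepFun_iff_measure_inter_preimage_eq_mul] at hindep_law ⊢
  intro s t hs ht
  have h := hindep_law s t hs ht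
  have hqp : Measurable fun ω => (q ω, p ω) := hq.prodMk hp
  have hX : Measurable fun z : ℝ × ℝ => z.1 / z.2 := by fun_prop
  have hY : Measurable fun z : ℝ × ℝ => z.1 ^ 2 + z.2 ^ 2 := by fun_prop
  rw [← hlaw, Measure.map_apply hqp ((hX hs).inter (hY ht)), Measure.map_apply hqp (hX hs),
    Measure.map_apply hqp (hY ht)] at h
  exact h
end

section
/- For all real numbers t₁ and t₂, the joint characteristic function of (q/p, (q²+p²)/2) under two independent standard normals factorizes as a product of the Cauchy and exponential characteristic functions; explicitly, (1/(2π)) ∫_{ℝ²} exp(i·t₁·(q/p) + i·t₂·(q²+p²)/2) · exp(−(q²+p²)/2) dq dp = (∫_ℝ exp(i·t₁·x) · (1/(π(1+x²))) dx) · (∫₀^∞ exp(i·t₂·x) · e^{−x} dx). -/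
open MeasureTheory Real

/-- Substituting `x = r² / 2` on the positive half-line. -/
theorem integral_Ioi_smul_comp_sq_half {E : Type*} [NormedAddCommGroup E] [NormedSpace ℝ E]
    (f : ℝ → E) :
    ∫ r in Set.Ioi (0 : ℝ), r • f (r ^ 2 / 2) = ∫ x in Set.Ioi (0 : ℝ), f x := by
  have himage : (fun r : ℝ => r ^ 2 / 2) '' Set.Ioi 0 = Set.Ioi 0 := by
    ext y
    simp only [Set.mem_image, Set.mem_Ioi]
    constructor
    · rintro ⟨r, hr, rfl⟩
      positivity
    · intro hy
      refine ⟨√(2 * y), by positivity, ?_⟩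
      rw [sq_sqrt (by positivity)]
      ring
  have hinj : Set.InjOn (fun r : ℝ => r ^ 2 / 2) (Set.Ioi 0) := by
    intro a ha b hb hab
    have ha' : 0 < a := ha
    have hb' : 0 < b := hb
    exact (pow_left_inj₀ ha'.le hb'.le two_ne_zero).1 (by dsimp only at hab; linarith)
  have hderiv : ∀ r ∈ Set.Ioi (0 : ℝ),
      HasDerivWithinAt (fun r : ℝ => r ^ 2 / 2) r (Set.Ioi 0) r := by
    intro r _
    have h := ((hasDerivAt_pow 2 r).div_const 2).hasDerivWithinAt (s := Set.Ioi 0)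
    convert! h using 1
    push_cast
    ring
  have h := integral_image_eq_integral_abs_deriv_smul measurableSet_Ioi hderiv hinj f
  rw [himage] at h
  rw [h]
  refine setIntegral_congr_fun measurableSet_Ioi fun r hr => ?_
  simp only [abs_of_pos (Set.mem_Ioi.1 hr)]

/-- Substituting `x = tan θ` over the real line. -/
theorem integral_Ioo_comp_tan {E : Type*} [NormedAddCommGroup E] [NormedSpace ℝ E]
    (f : ℝ → E) :
    ∫ θ in Set.Ioo (-(π / 2)) (π / 2), f (tan θ) = ∫ x : ℝ, (1 / (1 + x ^ 2)) • f x := by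
  have h := integral_image_eq_integral_abs_deriv_smul MeasurableSet.univ
    (fun x _ => (hasDerivAt_arctan x).hasDerivWithinAt) arctan_injective.injOn
    (fun θ => f (tan θ))
  rw [Set.image_univ, range_arctan, setIntegral_univ] at h
  rw [h]
  refine integral_congr_ae (.of_forall fun x => ?_)
  have hx : 0 < 1 / (1 + x ^ 2) := by positivity
  simp only [tan_arctan, abs_of_pos hx]

/-- The cotangent of a uniform angle over a full turn covers the line twice. -/
theorem integral_Ioo_comp_cos_div_sin {E : Type*} [NormedAddCommGroup E] [NormedSpace ℝ E]
    {f : ℝ → E} (hf : IntervalIntegrable (fun θ => f (cos θ / sin θ)) volume 0 π) :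
    ∫ θ in Set.Ioo (-π) π, f (cos θ / sin θ) =
      (2 : ℝ) • ∫ x : ℝ, (1 / (1 + x ^ 2)) • f x := by
  have hper : Function.Periodic (fun θ => f (cos θ / sin θ)) π := fun θ => by
    simp only [cos_add_pi, sin_add_pi, neg_div_neg_eq]
  rw [← integral_Ioo_comp_tan, ← integral_Ioc_eq_integral_Ioo, ← integral_Ioc_eq_integral_Ioo,
    ← intervalIntegral.integral_of_le (by linarith [pi_pos]),
    ← intervalIntegral.integral_of_le (by linarith [pi_pos])]
  have hturn := hper.intervalIntegral_add_zsmul_eq 2 (-π)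
    (fun a b => hper.intervalIntegrable₀ pi_pos.ne' hf a b)
  have hshift := hper.intervalIntegral_add_eq (-π) 0
  have hreflect := intervalIntegral.integral_comp_sub_left (a := -(π / 2)) (b := π / 2)
    (fun θ => f (cos θ / sin θ)) (π / 2)
  simp only [cos_pi_div_two_sub, sin_pi_div_two_sub, ← tan_eq_sin_div_cos, sub_self,
    sub_neg_eq_add, add_halves] at hreflect
  rw [hreflect]
  rw [hshift, zero_add] at hturn
  have hend : -π + (2 : ℤ) • π = π := by simp; ring
  rw [hend] at hturn
  rw [hturn, ← Int.cast_smul_eq_zsmul ℝ]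
  norm_num

/-- The joint characteristic function of `(q/p, (q² + p²)/2)` under two independent standard
normals factorizes as the product of the Cauchy and `Exp(1)` characteristic functions. -/
theorem charFun_factorization (t₁ t₂ : ℝ) :
    (1 / (2 * Real.pi)) •
        ∫ x : ℝ × ℝ,
          Complex.exp (Complex.I * (t₁ : ℂ) * ((x.1 / x.2 : ℝ) : ℂ) +
              Complex.I * (t₂ : ℂ) * (((x.1 ^ 2 + x.2 ^ 2) / 2 : ℝ) : ℂ)) *
            (Real.exp (-((x.1 ^ 2 + x.2 ^ 2) / 2)) : ℂ) =
      (∫ x : ℝ, Complex.exp (Complex.I * (t₁ : ℂ) * (x : ℂ)) *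
          ((1 / (Real.pi * (1 + x ^ 2)) : ℝ) : ℂ)) *
        ∫ x in Set.Ioi (0 : ℝ), Complex.exp (Complex.I * (t₂ : ℂ) * (x : ℂ)) *
          (Real.exp (-x) : ℂ) := by
  have hcot : IntervalIntegrable
      (fun θ => Complex.exp (Complex.I * (t₁ : ℂ) * ((cos θ / sin θ : ℝ) : ℂ)))
      volume 0 π := by
    refine (intervalIntegrable_const (c := (1 : ℝ))).mono_fun ?_ (.of_forall fun θ => ?_)
    · exact Measurable.aestronglyMeasurable (by fun_prop)
    · dsimp only
      generalize cos θ / sin θ = x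
      simp [Complex.norm_exp]
  have hangle := integral_Ioo_comp_cos_div_sin
    (f := fun x : ℝ => Complex.exp (Complex.I * (t₁ : ℂ) * (x : ℂ))) hcot
  have hradius := integral_Ioi_smul_comp_sq_half
    (fun x : ℝ => Complex.exp (Complex.I * (t₂ : ℂ) * (x : ℂ)) * (Real.exp (-x) : ℂ))
  have hcauchy : ∫ x : ℝ, Complex.exp (Complex.I * (t₁ : ℂ) * (x : ℂ)) *
      ((1 / (Real.pi * (1 + x ^ 2)) : ℝ) : ℂ) =
      (1 / π) • ∫ x : ℝ, (1 / (1 + x ^ 2)) • Complex.exp (Complex.I * (t₁ : ℂ) * (x : ℂ)) := by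
    rw [← integral_smul]
    refine integral_congr_ae (.of_forall fun x => ?_)
    simp only [Complex.real_smul]
    push_cast
    simp only [one_div, mul_inv]
    ring
  have hpolar : ∀ x ∈ polarCoord.target,
      x.1 • (Complex.exp (Complex.I * (t₁ : ℂ) * (((polarCoord.symm x).1 /
          (polarCoord.symm x).2 : ℝ) : ℂ) + Complex.I * (t₂ : ℂ) *
          ((((polarCoord.symm x).1 ^ 2 + (polarCoord.symm x).2 ^ 2) / 2 : ℝ) : ℂ)) *
        (Real.exp (-(((polarCoord.symm x).1 ^ 2 + (polarCoord.symm x).2 ^ 2) / 2)) : ℂ)) =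
      (x.1 • (Complex.exp (Complex.I * (t₂ : ℂ) * ((x.1 ^ 2 / 2 : ℝ) : ℂ)) *
        (Real.exp (-(x.1 ^ 2 / 2)) : ℂ))) *
      Complex.exp (Complex.I * (t₁ : ℂ) * ((cos x.2 / sin x.2 : ℝ) : ℂ)) := by
    rintro ⟨r, θ⟩ ⟨hr, -⟩
    have hr' : r ≠ 0 := (Set.mem_Ioi.1 hr).ne'
    have hsq : (r * cos θ) ^ 2 + (r * sin θ) ^ 2 = r ^ 2 := by
      rw [mul_pow, mul_pow, ← mul_add, cos_sq_add_sin_sq, mul_one]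
    simp only [polarCoord_symm_apply, hsq, mul_div_mul_left _ _ hr', Complex.exp_add,
      Complex.real_smul]
    ring
  rw [← integral_comp_polarCoord_symm,
    setIntegral_congr_fun polarCoord.open_target.measurableSet hpolar, polarCoord_target,
    Measure.volume_eq_prod,
    setIntegral_prod_mul (fun r : ℝ => r • (Complex.exp (Complex.I * (t₂ : ℂ) *
      ((r ^ 2 / 2 : ℝ) : ℂ)) * (Real.exp (-(r ^ 2 / 2)) : ℂ)))
      (fun θ : ℝ => Complex.exp (Complex.I * (t₁ : ℂ) * ((cos θ / sin θ : ℝ) : ℂ))),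
    hradius, hangle, hcauchy, mul_smul_comm, smul_smul, smul_mul_assoc]
  congr 1
  · field_simp
  · exact mul_comm _ _
end

section
/- Let u be uniformly distributed on [0,1] and let p be an independent real random variable with the Laplace distribution of density (1/2)·e^{−|x|}. Define t = 1 − u if p > 0 and t = u if p < 0 (defined almost surely since p ≠ 0 almost surely), and define k = |p|. Then t and k are independent, t is uniformly distributed on [0,1], and k has the exponential distribution Exp(1). Equivalently, the pushforward of Uniform([0,1]) ⊗ Laplace under the map (u,p) ↦ (t, k) is the product of the uniform probability measure on [0,1] and Exp(1). -/
open MeasureTheory ProbabilityTheory Real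

theorem lintegral_comp_abs_eq_two_mul (h : ℝ → ENNReal) :
    ∫⁻ x, h |x| = 2 * ∫⁻ x in Set.Ioi 0, h x := by
  rw [← lintegral_add_compl _ (measurableSet_Ioi (a := (0 : ℝ))), two_mul]
  congr 1
  · exact setLIntegral_congr_fun measurableSet_Ioi fun x hx => by
      simp only [abs_of_pos (Set.mem_Ioi.mp hx)]
  · rw [Set.compl_Ioi, ← setLIntegral_congr (Iio_ae_eq_Iic (a := (0 : ℝ)) (μ := volume)),
      ← (Measure.measurePreserving_neg (volume : Measure ℝ)).setLIntegral_comp_preimage_emb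
        (MeasurableEquiv.neg ℝ).measurableEmbedding]
    have hpre : (Neg.neg : ℝ → ℝ) ⁻¹' Set.Iio 0 = Set.Ioi 0 := by ext; simp
    rw [hpre]
    exact setLIntegral_congr_fun measurableSet_Ioi fun x hx => by
      simp only [abs_neg, abs_of_pos (Set.mem_Ioi.mp hx)]

theorem map_abs_laplace :
    Measure.map (fun x : ℝ => |x|)
      (volume.withDensity fun x => ENNReal.ofReal ((1 / 2) * Real.exp (-|x|))) =
      expMeasure 1 := by
  ext s hs
  have habs : Measurable fun x : ℝ => |x| := measurable_norm
  have hpre : MeasurableSet ((fun x : ℝ => |x|) ⁻¹' s) := habs hs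
  have hexp : expMeasure 1 s = ∫⁻ x in s, exponentialPDF 1 x := withDensity_apply _ hs
  rw [Measure.map_apply habs hs, withDensity_apply _ hpre, hexp,
    ← lintegral_indicator hpre, ← lintegral_indicator hs]
  have hcomp : ((fun x : ℝ => |x|) ⁻¹' s).indicator
      (fun x => ENNReal.ofReal ((1 / 2) * Real.exp (-|x|))) =
      fun x => s.indicator (fun y => ENNReal.ofReal ((1 / 2) * Real.exp (-y))) |x| :=
    rfl
  rw [hcomp, lintegral_comp_abs_eq_two_mul, ← lintegral_const_mul' _ _ (by simp),
    setLIntegral_congr (Ioi_ae_eq_Ici (a := (0 : ℝ)) (μ := volume)),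
    ← lintegral_indicator measurableSet_Ici]
  refine lintegral_congr fun x => ?_
  by_cases hx : 0 ≤ x
  · by_cases hxs : x ∈ s
    · rw [Set.indicator_of_mem (Set.mem_Ici.mpr hx), Set.indicator_of_mem hxs,
        Set.indicator_of_mem hxs, exponentialPDF_of_nonneg hx, ← ENNReal.ofReal_ofNat 2,
        ← ENNReal.ofReal_mul (by norm_num)]
      ring_nf
    · simp [hxs]
  · rw [Set.indicator_of_notMem (by simpa using hx)]
    by_cases hxs : x ∈ s
    · rw [Set.indicator_of_mem hxs, exponentialPDF_of_neg (not_le.mp hx)]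
    · rw [Set.indicator_of_notMem hxs]

theorem map_one_sub_restrict_Icc :
    Measure.map (fun x : ℝ => 1 - x) (volume.restrict (Set.Icc (0 : ℝ) 1)) =
      volume.restrict (Set.Icc (0 : ℝ) 1) := by
  have h := (Measure.measurePreserving_sub_left (volume : Measure ℝ) 1).restrict_preimage
    (measurableSet_Icc (a := (0 : ℝ)) (b := 1))
  have hpre : (fun x : ℝ => 1 - x) ⁻¹' Set.Icc 0 1 = Set.Icc 0 1 := by simp
  rw [hpre] at h
  exact h.map_eq

/-- Let `u` be uniform on `[0,1]` and `p` an independent Laplace random variable (density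
`(1/2) * exp (-|x|)`). Set `t = 1 - u` if `p > 0` and `t = u` otherwise, and `k = |p|`. Then the
joint law of `(t, k)` is the product of the uniform distribution on `[0,1]` and `Exp(1)`; in
particular `t` and `k` are independent with these laws. -/
theorem laplace_MHMC_hit_time_energy :
    Measure.map
        (fun x : ℝ × ℝ => ((if 0 < x.2 then 1 - x.1 else x.1), |x.2|))
        ((volume.restrict (Set.Icc (0 : ℝ) 1)).prod
          (volume.withDensity fun x => ENNReal.ofReal ((1 / 2) * Real.exp (-|x|)))) =
      (volume.restrict (Set.Icc (0 : ℝ) 1)).prod (expMeasure 1) := by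
  have : IsProbabilityMeasure (expMeasure 1) := isProbabilityMeasure_expMeasure one_pos
  have habs : MeasurePreserving (fun x : ℝ => |x|)
      (volume.withDensity fun x => ENNReal.ofReal ((1 / 2) * Real.exp (-|x|)))
      (expMeasure 1) := ⟨measurable_norm, map_abs_laplace⟩
  have hmeas : Measurable (Function.uncurry fun p u : ℝ => if 0 < p then 1 - u else u) :=
    Measurable.ite (measurableSet_lt measurable_const measurable_fst)
      (measurable_const.sub measurable_snd) measurable_snd
  have hskew := habs.skew_product (μc := volume.restrict (Set.Icc (0 : ℝ) 1))
    (μd := volume.restrict (Set.Icc (0 : ℝ) 1)) hmeas (Filter.Eventually.of_forall fun p => by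
      by_cases hp : 0 < p
      · simpa only [hp, if_true] using map_one_sub_restrict_Icc
      · simp only [hp, if_false, Measure.map_id'])
  exact ((Measure.measurePreserving_swap.comp hskew).comp Measure.measurePreserving_swap).map_eq
end

section
/- Let μ₁ be the product measure on [0,∞) × ℝ of the exponential distribution Exp(1) and the standard normal distribution N(0,1), and define F : [0,∞) × ℝ → ℝ² by F(q, p) = ( p + √(p² + 2q), q + p²/2 ). Let μ₂ be the product measure on [0,1] × ℝ of the uniform distribution on [0,1] and the probability measure ν on ℝ with density (2/(3√π))·e^{−|x|^{2/3}} with respect to Lebesgue measure, and define G : [0,1] × ℝ → ℝ² by G(q, p) = ( 2√2 · q · |p|^{1/3}, |p|^{2/3} ). Then the pushforward measures coincide: F_*μ₁ = G_*μ₂ as measures on ℝ². -/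
open MeasureTheory ProbabilityTheory Real

open scoped ENNReal

/-- Joint density of hitting time `t` and energy `e`, weighted by a test function `f`. -/
noncomputable def hittingEnergyIntegrand (f : ℝ × ℝ → ℝ≥0∞) (e t : ℝ) : ℝ≥0∞ :=
  if (t - √(2 * e)) ^ 2 ≤ 2 * e then ENNReal.ofReal ((√(2 * π))⁻¹ * rexp (-e)) * f (t, e) else 0

lemma measurable_hittingEnergyIntegrand {f : ℝ × ℝ → ℝ≥0∞} (hf : Measurable f) :
    Measurable fun z : ℝ × ℝ => hittingEnergyIntegrand f z.1 z.2 := by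
  unfold hittingEnergyIntegrand
  refine Measurable.ite (measurableSet_le (by fun_prop) (by fun_prop)) ?_ measurable_const
  fun_prop

lemma lintegral_expMeasure_prod_gaussianReal {f : ℝ × ℝ → ℝ≥0∞} (hf : Measurable f) :
    ∫⁻ x, f (x.2 + √(x.2 ^ 2 + 2 * x.1), x.1 + x.2 ^ 2 / 2)
        ∂((expMeasure 1).prod (gaussianReal 0 1)) =
      ∫⁻ e, ∫⁻ t, hittingEnergyIntegrand f e t := by
  have hK := measurable_hittingEnergyIntegrand hf
  have hsub (p : ℝ) : gaussianPDF 0 1 p *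
      ∫⁻ q, f (p + √(p ^ 2 + 2 * q), q + p ^ 2 / 2) ∂(expMeasure 1) =
      ∫⁻ e, hittingEnergyIntegrand f e (p + √(2 * e)) := by
    rw [expMeasure, gammaMeasure]
    change _ * lintegral (volume.withDensity (exponentialPDF 1)) _ = _
    have hm : Measurable (exponentialPDF 1) := (measurable_exponentialPDFReal 1).ennreal_ofReal
    rw [lintegral_withDensity_eq_lintegral_mul _ hm (by fun_prop),
      ← lintegral_const_mul _ (by fun_prop), ← lintegral_add_right_eq_self
        (fun e => hittingEnergyIntegrand f e (p + √(2 * e))) (p ^ 2 / 2)]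
    refine lintegral_congr fun q => ?_
    have h2 : 2 * (q + p ^ 2 / 2) = p ^ 2 + 2 * q := by ring
    simp only [hittingEnergyIntegrand, Pi.mul_apply, h2, exponentialPDF_eq, gaussianPDF,
      gaussianPDFReal, add_sub_cancel_right]
    by_cases hq : 0 ≤ q
    · rw [if_pos hq, if_pos (by linarith), ← mul_assoc, ← ENNReal.ofReal_mul (by positivity)]
      congr 2
      simp only [NNReal.coe_one, mul_one, one_mul, sub_zero]
      rw [mul_assoc, ← Real.exp_add]
      congr 2
      ring
    · rw [if_neg hq, if_neg (by linarith)]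
      simp
  calc
    _ = ∫⁻ p, ∫⁻ q, f (p + √(p ^ 2 + 2 * q), q + p ^ 2 / 2) ∂(expMeasure 1)
          ∂(gaussianReal 0 1) := by
      have := isProbabilityMeasure_expMeasure one_pos
      exact lintegral_prod_symm' _ (by fun_prop)
    _ = ∫⁻ p, ∫⁻ e, hittingEnergyIntegrand f e (p + √(2 * e)) := by
      have := isProbabilityMeasure_expMeasure one_pos
      rw [gaussianReal_of_var_ne_zero _ one_ne_zero,
        lintegral_withDensity_eq_lintegral_mul _ (measurable_gaussianPDF 0 1)
          (Measurable.lintegral_prod_right' (f := fun z : ℝ × ℝ =>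
            f (z.1 + √(z.1 ^ 2 + 2 * z.2), z.2 + z.1 ^ 2 / 2)) (by fun_prop))]
      exact lintegral_congr hsub
    _ = ∫⁻ e, ∫⁻ p, hittingEnergyIntegrand f e (p + √(2 * e)) :=
      lintegral_lintegral_swap (hK.comp (g := fun z : ℝ × ℝ => hittingEnergyIntegrand f z.1 z.2)
        (f := fun z : ℝ × ℝ => (z.2, z.1 + √(2 * z.2))) (by fun_prop)).aemeasurable
    _ = _ := lintegral_congr fun e => lintegral_add_right_eq_self _ _

lemma lintegral_eq_setLIntegral_Ioi (f : ℝ → ℝ≥0∞) (hf : ∀ e < 0, f e = 0) :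
    ∫⁻ e, f e = ∫⁻ e in Set.Ioi 0, f e := by
  rw [setLIntegral_congr Ioi_ae_eq_Ici, ← lintegral_indicator measurableSet_Ici]
  refine lintegral_congr fun e => ?_
  by_cases he : e ∈ Set.Ici 0
  · rw [Set.indicator_of_mem he]
  · rw [Set.indicator_of_notMem he, hf e (not_le.mp (mt Set.mem_Ici.mpr he))]

lemma lintegral_comp_abs (f : ℝ → ℝ≥0∞) :
    ∫⁻ x, f |x| = 2 * ∫⁻ x in Set.Ioi 0, f x := by
  have hpos : ∫⁻ x in Set.Ioi 0, f |x| = ∫⁻ x in Set.Ioi 0, f x :=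
    setLIntegral_congr_fun measurableSet_Ioi fun x hx => by
      simp only [abs_of_pos (Set.mem_Ioi.mp hx)]
  have hneg : ∫⁻ x in Set.Iic 0, f |x| = ∫⁻ x in Set.Ioi 0, f x := by
    rw [← hpos, ← setLIntegral_congr Iio_ae_eq_Iic, ← (Measure.measurePreserving_neg
      (volume : Measure ℝ)).setLIntegral_comp_preimage_emb
        (MeasurableEquiv.neg ℝ).measurableEmbedding (fun x => f |x|) (Set.Iio 0)]
    simp
  rw [← lintegral_add_compl _ (measurableSet_Ioi (a := (0 : ℝ))), Set.compl_Ioi, hpos, hneg,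
    two_mul]

lemma setLIntegral_Ioi_comp_rpow {a : ℝ} (ha : 0 < a) (f : ℝ → ℝ≥0∞) :
    ∫⁻ x in Set.Ioi 0, f x =
      ∫⁻ e in Set.Ioi 0, ENNReal.ofReal (a * e ^ (a - 1)) * f (e ^ a) := by
  have himage : (fun e : ℝ => e ^ a) '' Set.Ioi 0 = Set.Ioi 0 := by
    ext x
    constructor
    · rintro ⟨e, he, rfl⟩
      exact Real.rpow_pos_of_pos he a
    · intro hx
      exact ⟨x ^ a⁻¹, Real.rpow_pos_of_pos hx _, Real.rpow_inv_rpow (le_of_lt hx) ha.ne'⟩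
  conv_lhs => rw [← himage]
  rw [lintegral_image_eq_lintegral_abs_deriv_mul measurableSet_Ioi
    (fun x hx => (Real.hasDerivAt_rpow_const (p := a) (Or.inl (ne_of_gt hx))).hasDerivWithinAt)
    (fun x hx y hy h => (Real.rpow_left_inj (le_of_lt hx) (le_of_lt hy) ha.ne').mp h)]
  refine setLIntegral_congr_fun measurableSet_Ioi fun e he => ?_
  have : 0 ≤ a * e ^ (a - 1) := mul_nonneg ha.le (Real.rpow_nonneg (le_of_lt he) _)
  simp only [abs_of_nonneg this]

lemma ofReal_mul_setLIntegral_Icc_comp_mul {c : ℝ} (hc : 0 < c) {f : ℝ → ℝ≥0∞}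
    (hf : Measurable f) :
    ENNReal.ofReal c * ∫⁻ q in Set.Icc 0 1, f (c * q) = ∫⁻ t in Set.Icc 0 c, f t := by
  have hg : Measurable ((Set.Icc 0 c).indicator f) := hf.indicator measurableSet_Icc
  rw [← lintegral_indicator measurableSet_Icc, ← lintegral_indicator measurableSet_Icc]
  conv_rhs => rw [← Real.smul_map_volume_mul_left hc.ne']
  rw [lintegral_smul_measure, lintegral_map hg (by fun_prop), abs_of_pos hc, smul_eq_mul]
  congr 1
  refine lintegral_congr fun q => ?_
  have h : c * q ∈ Set.Icc 0 c ↔ q ∈ Set.Icc (0 : ℝ) 1 := by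
    simp only [Set.mem_Icc, mul_nonneg_iff_of_pos_left hc, mul_le_iff_le_one_right hc]
  by_cases hq : q ∈ Set.Icc (0 : ℝ) 1
  · rw [Set.indicator_of_mem hq, Set.indicator_of_mem (h.mpr hq)]
  · rw [Set.indicator_of_notMem hq, Set.indicator_of_notMem (mt h.mp hq)]

lemma lintegral_hittingEnergyIntegrand {f : ℝ × ℝ → ℝ≥0∞} (hf : Measurable f) {e : ℝ}
    (he : 0 ≤ e) :
    ∫⁻ t, hittingEnergyIntegrand f e t =
      ENNReal.ofReal ((√(2 * π))⁻¹ * rexp (-e)) *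
        ∫⁻ t in Set.Icc 0 (2 * √2 * √e), f (t, e) := by
  rw [← lintegral_const_mul _ (by fun_prop), ← lintegral_indicator measurableSet_Icc]
  refine lintegral_congr fun t => ?_
  have hs : √(2 * e) = √2 * √e := Real.sqrt_mul zero_le_two e
  have h : (t - √(2 * e)) ^ 2 ≤ 2 * e ↔ t ∈ Set.Icc 0 (2 * √2 * √e) := by
    rw [Real.sq_le (by positivity), mul_assoc, ← hs, Set.mem_Icc]
    constructor <;> rintro ⟨h1, h2⟩ <;> constructor <;> linarith
  rw [hittingEnergyIntegrand, Set.indicator_apply]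
  simp only [h]

lemma lintegral_uniform_prod_rpow_density {f : ℝ × ℝ → ℝ≥0∞} (hf : Measurable f) :
    ∫⁻ x, f (2 * √2 * x.1 * |x.2| ^ ((1 : ℝ) / 3), |x.2| ^ ((2 : ℝ) / 3))
        ∂((volume.restrict (Set.Icc (0 : ℝ) 1)).prod (volume.withDensity fun x =>
          ENNReal.ofReal (2 / (3 * √π) * rexp (-(|x| ^ ((2 : ℝ) / 3)))))) =
      ∫⁻ e, ∫⁻ t, hittingEnergyIntegrand f e t := by
  rw [lintegral_prod_symm' _ (by fun_prop),
    lintegral_withDensity_eq_lintegral_mul _ (by fun_prop)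
      (Measurable.lintegral_prod_right' (f := fun z : ℝ × ℝ =>
        f (2 * √2 * z.2 * |z.1| ^ ((1 : ℝ) / 3), |z.1| ^ ((2 : ℝ) / 3))) (by fun_prop))]
  simp only [Pi.mul_apply]
  rw [lintegral_comp_abs (fun r => ENNReal.ofReal (2 / (3 * √π) *
      rexp (-(r ^ ((2 : ℝ) / 3)))) * ∫⁻ q in Set.Icc (0 : ℝ) 1,
        f (2 * √2 * q * r ^ ((1 : ℝ) / 3), r ^ ((2 : ℝ) / 3))),
    setLIntegral_Ioi_comp_rpow (a := 3 / 2) (by norm_num),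
    ← lintegral_const_mul' _ _ ENNReal.ofNat_ne_top, lintegral_eq_setLIntegral_Ioi]
  · refine setLIntegral_congr_fun measurableSet_Ioi fun e he => ?_
    have he : 0 < e := he
    have hse : 0 < √e := Real.sqrt_pos.mpr he
    have h1 : (e ^ ((3 : ℝ) / 2)) ^ ((1 : ℝ) / 3) = √e := by
      rw [← Real.rpow_mul he.le, Real.sqrt_eq_rpow]; norm_num
    have h2 : (e ^ ((3 : ℝ) / 2)) ^ ((2 : ℝ) / 3) = e := by
      rw [← Real.rpow_mul he.le]; norm_num
    have h3 : e ^ ((3 : ℝ) / 2 - 1) = √e := by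
      rw [Real.sqrt_eq_rpow]; norm_num
    have h4 (q : ℝ) : 2 * √2 * q * √e = 2 * √2 * √e * q := by ring
    simp only [h1, h2, h3, h4]
    rw [lintegral_hittingEnergyIntegrand hf he.le,
      ← ofReal_mul_setLIntegral_Icc_comp_mul (c := 2 * √2 * √e) (by positivity)
        (f := fun t => f (t, e)) (by fun_prop),
      ← mul_assoc, ← mul_assoc, ← mul_assoc]
    congr 1
    rw [← ENNReal.ofReal_ofNat, ← ENNReal.ofReal_mul (by positivity),
      ← ENNReal.ofReal_mul (by positivity), ← ENNReal.ofReal_mul (by positivity),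
      Real.sqrt_mul zero_le_two]
    congr 1
    have : 0 < √π := Real.sqrt_pos.mpr Real.pi_pos
    field_simp
  · intro e he
    have h (t : ℝ) : hittingEnergyIntegrand f e t = 0 :=
      if_neg (not_le.mpr (lt_of_lt_of_le (by linarith) (sq_nonneg _)))
    simp [h]

/-- The pushforward of `Exp(1) ⊗ N(0,1)` under
`F (q, p) = (p + √(p² + 2q), q + p²/2)` (the initial hitting time and total energy of
exponential binary HMC) equals the pushforward of `Uniform([0,1]) ⊗ ν`, where `ν` has density
`(2 / (3√π)) * exp (-|x|^(2/3))`, under `G (q, p) = (2√2 * q * |p|^(1/3), |p|^(2/3))`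
(the rescaled hitting time and energy of M-HMC with `β = 2/3`). -/
theorem expBinaryHMC_eq_MHMC_pushforward :
    Measure.map
        (fun x : ℝ × ℝ => ((x.2 + Real.sqrt (x.2 ^ 2 + 2 * x.1), x.1 + x.2 ^ 2 / 2) : ℝ × ℝ))
        ((expMeasure 1).prod (gaussianReal 0 1)) =
      Measure.map
        (fun x : ℝ × ℝ =>
          ((2 * Real.sqrt 2 * x.1 * |x.2| ^ ((1 : ℝ) / 3), |x.2| ^ ((2 : ℝ) / 3)) : ℝ × ℝ))
        ((volume.restrict (Set.Icc (0 : ℝ) 1)).prod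
          (volume.withDensity fun x =>
            ENNReal.ofReal (2 / (3 * Real.sqrt Real.pi) * Real.exp (-(|x| ^ ((2 : ℝ) / 3)))))) := by
  refine Measure.ext_of_lintegral _ fun f hf => ?_
  rw [lintegral_map hf (by fun_prop), lintegral_map hf (by fun_prop),
    lintegral_expMeasure_prod_gaussianReal hf, lintegral_uniform_prod_rpow_density hf]
end

section
/- For all real numbers t₁ and t₂, the following equality of complex-valued integrals holds: (1/√(2π)) ∫₀^∞ ∫_ℝ exp( i·t₁·(p + √(p² + 2q)) + i·t₂·(q + p²/2) ) · e^{−q} · e^{−p²/2} dp dq = (4/(3√π)) ∫₀^1 ∫₀^∞ exp( i·t₁·2√2·q·p^{1/3} + i·t₂·p^{2/3} ) · e^{−p^{2/3}} dp dq. -/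
open MeasureTheory Real

/-- The common integrand in the coordinates `x` (displacement) and `E` (energy):
`exp (i t₁ x + i t₂ E) * exp (-E)`. -/
noncomputable def displacementEnergyKernel (t₁ t₂ x E : ℝ) : ℂ :=
  Complex.exp (Complex.I * (t₁ : ℂ) * (x : ℂ) + Complex.I * (t₂ : ℂ) * (E : ℂ)) *
    (Real.exp (-E) : ℂ)

lemma norm_displacementEnergyKernel (t₁ t₂ x E : ℝ) :
    ‖displacementEnergyKernel t₁ t₂ x E‖ = Real.exp (-E) := by
  have h : Complex.I * (t₁ : ℂ) * (x : ℂ) + Complex.I * (t₂ : ℂ) * (E : ℂ) =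
      ((t₁ * x + t₂ * E : ℝ) : ℂ) * Complex.I := by
    push_cast
    ring
  rw [displacementEnergyKernel, h, norm_mul, Complex.norm_exp_ofReal_mul_I, one_mul,
    Complex.norm_real, Real.norm_of_nonneg (Real.exp_pos _).le]

@[fun_prop]
lemma Continuous.displacementEnergyKernel {X : Type*} [TopologicalSpace X] {t₁ t₂ : ℝ}
    {x E : X → ℝ} (hx : Continuous x) (hE : Continuous E) :
    Continuous fun a ↦ displacementEnergyKernel t₁ t₂ (x a) (E a) := by
  unfold _root_.displacementEnergyKernel
  fun_prop

lemma integrable_exp_neg_prod_gaussian :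
    Integrable (fun z : ℝ × ℝ ↦ Real.exp (-z.1) * Real.exp (-(z.2 ^ 2 / 2)))
      ((volume.restrict (Set.Ioi 0)).prod volume) := by
  have h₁ : Integrable (fun q : ℝ ↦ Real.exp (-q)) (volume.restrict (Set.Ioi 0)) := by
    simpa [IntegrableOn] using exp_neg_integrableOn_Ioi 0 one_pos
  have h₂ : Integrable (fun p : ℝ ↦ Real.exp (-(p ^ 2 / 2))) := by
    refine (integrable_exp_neg_mul_sq (b := 1 / 2) (by norm_num)).congr (.of_forall fun p ↦ ?_)
    dsimp only
    congr 1
    ring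
  exact h₁.mul_prod h₂

/-- On the region `p² / 2 < E`, the weight `exp (-E)` is integrable in `(p, E)`. -/
lemma integrable_indicator_displacementEnergyKernel (t₁ t₂ : ℝ) :
    Integrable (Function.uncurry fun p E : ℝ ↦ (Set.Ioi (p ^ 2 / 2)).indicator
        (fun E ↦ displacementEnergyKernel t₁ t₂ (p + √(2 * E)) E) E)
      (volume.prod (volume.restrict (Set.Ioi 0))) := by
  have h₁ : Integrable (fun E : ℝ ↦ Real.exp (-(1 / 2) * E)) (volume.restrict (Set.Ioi 0)) :=
    exp_neg_integrableOn_Ioi 0 (by norm_num)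
  have h₂ : Integrable (fun p : ℝ ↦ Real.exp (-(1 / 4) * p ^ 2)) :=
    integrable_exp_neg_mul_sq (by norm_num)
  refine (h₂.mul_prod h₁).mono' ?_ (.of_forall fun ⟨p, E⟩ ↦ ?_)
  · have hs : MeasurableSet {z : ℝ × ℝ | z.1 ^ 2 / 2 < z.2} :=
      measurableSet_lt (by fun_prop) (by fun_prop)
    have hc : Continuous fun z : ℝ × ℝ ↦
        displacementEnergyKernel t₁ t₂ (z.1 + √(2 * z.2)) z.2 := by fun_prop
    exact (hc.measurable.indicator hs).aestronglyMeasurable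
  · by_cases h : E ∈ Set.Ioi (p ^ 2 / 2)
    · simp only [Function.uncurry_apply_pair, Set.indicator_of_mem h,
        norm_displacementEnergyKernel, ← Real.exp_add]
      rw [Real.exp_le_exp]
      rw [Set.mem_Ioi] at h
      linarith
    · simp only [Function.uncurry_apply_pair, Set.indicator_of_notMem h, norm_zero]
      positivity

lemma integral_indicator_displacementEnergyKernel (t₁ t₂ : ℝ) {E : ℝ} (hE : 0 < E) :
    ∫ p : ℝ, (Set.Ioi (p ^ 2 / 2)).indicator
        (fun E ↦ displacementEnergyKernel t₁ t₂ (p + √(2 * E)) E) E =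
      ∫ u in Set.Ioc (0 : ℝ) 1,
        (2 * √(2 * E)) • displacementEnergyKernel t₁ t₂ (2 * √(2 * E) * u) E := by
  set s := √(2 * E) with hs
  have hs0 : 0 < s := Real.sqrt_pos.2 (by positivity)
  have hss : s ^ 2 = 2 * E := Real.sq_sqrt (by positivity)
  have hind (p : ℝ) : (Set.Ioi (p ^ 2 / 2)).indicator
        (fun E ↦ displacementEnergyKernel t₁ t₂ (p + √(2 * E)) E) E =
      (Set.Ioo (-s) s).indicator (fun p ↦ displacementEnergyKernel t₁ t₂ (p + s) E) p := by
    have hmem : E ∈ Set.Ioi (p ^ 2 / 2) ↔ p ∈ Set.Ioo (-s) s := by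
      rw [Set.mem_Ioi, Set.mem_Ioo, ← abs_lt, ← sq_lt_sq₀ (abs_nonneg p) hs0.le, sq_abs, hss]
      constructor <;> intro h <;> linarith
    simp only [Set.indicator_apply, hmem, hs]
  simp only [hind]
  rw [integral_indicator measurableSet_Ioo, ← integral_Ioc_eq_integral_Ioo,
    ← intervalIntegral.integral_of_le (by linarith), integral_smul,
    ← intervalIntegral.integral_of_le zero_le_one,
    intervalIntegral.smul_integral_comp_mul_left
      (fun x ↦ displacementEnergyKernel t₁ t₂ x E) (2 * s),
    intervalIntegral.integral_comp_add_right
      (fun x ↦ displacementEnergyKernel t₁ t₂ x E) s]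
  congr 1 <;> ring

lemma integrable_sqrt_smul_displacementEnergyKernel (t₁ t₂ : ℝ) :
    Integrable (Function.uncurry fun E u : ℝ ↦
        (2 * √(2 * E)) • displacementEnergyKernel t₁ t₂ (2 * √(2 * E) * u) E)
      ((volume.restrict (Set.Ioi 0)).prod (volume.restrict (Set.Ioc 0 1))) := by
  have h₁ : Integrable (fun E : ℝ ↦ 2 * √(2 * E) * Real.exp (-E))
      (volume.restrict (Set.Ioi 0)) := by
    refine ((Real.GammaIntegral_convergent (s := 3 / 2) (by norm_num)).const_mul
      (2 * √2)).congr (.of_forall fun E ↦ ?_)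
    dsimp only
    rw [Real.sqrt_mul zero_le_two, Real.sqrt_eq_rpow E]
    norm_num
    ring
  refine (h₁.mul_prod (integrable_const (1 : ℝ))).mono' ?_ (.of_forall fun ⟨E, u⟩ ↦ ?_)
  · have hc : Continuous fun z : ℝ × ℝ ↦ (2 * √(2 * z.1)) •
        displacementEnergyKernel t₁ t₂ (2 * √(2 * z.1) * z.2) z.1 := by fun_prop
    exact hc.aestronglyMeasurable
  · simp only [Function.uncurry_apply_pair, norm_smul, norm_displacementEnergyKernel, mul_one]
    rw [Real.norm_of_nonneg (by positivity)]

/-- The characteristic function integral against `Exp(1) ⊗ N(0,1)` (without normalization), after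
changing variables to the energy `E = q + p² / 2` and rescaling `p` to the unit interval. -/
lemma integral_exp_gaussian_eq (t₁ t₂ : ℝ) :
    ∫ q in Set.Ioi (0 : ℝ), ∫ p : ℝ,
        displacementEnergyKernel t₁ t₂ (p + √(p ^ 2 + 2 * q)) (q + p ^ 2 / 2) =
      ∫ u in Set.Ioc (0 : ℝ) 1, ∫ E in Set.Ioi (0 : ℝ),
        (2 * √(2 * E)) • displacementEnergyKernel t₁ t₂ (2 * √(2 * E) * u) E := by
  have hint : Integrable (Function.uncurry fun q p : ℝ ↦
        displacementEnergyKernel t₁ t₂ (p + √(p ^ 2 + 2 * q)) (q + p ^ 2 / 2))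
      ((volume.restrict (Set.Ioi 0)).prod volume) := by
    refine integrable_exp_neg_prod_gaussian.mono' ?_ (.of_forall fun ⟨q, p⟩ ↦ ?_)
    · have hc : Continuous fun z : ℝ × ℝ ↦ displacementEnergyKernel t₁ t₂
          (z.2 + √(z.2 ^ 2 + 2 * z.1)) (z.1 + z.2 ^ 2 / 2) := by fun_prop
      exact hc.aestronglyMeasurable
    · simp only [Function.uncurry_apply_pair, norm_displacementEnergyKernel, ← Real.exp_add]
      rw [neg_add]
  have hshift (p : ℝ) : ∫ q in Set.Ioi (0 : ℝ),
        displacementEnergyKernel t₁ t₂ (p + √(p ^ 2 + 2 * q)) (q + p ^ 2 / 2) =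
      ∫ E in Set.Ioi (0 : ℝ), (Set.Ioi (p ^ 2 / 2)).indicator
        (fun E ↦ displacementEnergyKernel t₁ t₂ (p + √(2 * E)) E) E := by
    have hsub : Set.Ioi (0 : ℝ) ∩ Set.Ioi (p ^ 2 / 2) = Set.Ioi (p ^ 2 / 2) :=
      Set.inter_eq_right.2 (Set.Ioi_subset_Ioi (by positivity))
    rw [setIntegral_indicator measurableSet_Ioi, hsub]
    have h := (measurePreserving_add_right volume (p ^ 2 / 2)).setIntegral_preimage_emb
      (measurableEmbedding_addRight _)
      (fun E ↦ displacementEnergyKernel t₁ t₂ (p + √(2 * E)) E) (Set.Ioi (p ^ 2 / 2))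
    rw [Set.preimage_add_const_Ioi, sub_self] at h
    rw [← h]
    congr 1 with q
    congr 3
    ring
  rw [integral_integral_swap hint]
  simp only [hshift]
  rw [integral_integral_swap (integrable_indicator_displacementEnergyKernel t₁ t₂),
    setIntegral_congr_fun measurableSet_Ioi
      fun E hE ↦ integral_indicator_displacementEnergyKernel t₁ t₂ hE,
    integral_integral_swap (integrable_sqrt_smul_displacementEnergyKernel t₁ t₂)]

/-- The substitution `p = E ^ (3 / 2)`. -/
lemma integral_comp_rpow_displacementEnergyKernel (t₁ t₂ u : ℝ) :
    ∫ p in Set.Ioi (0 : ℝ),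
        displacementEnergyKernel t₁ t₂ (2 * √2 * u * p ^ ((1 : ℝ) / 3)) (p ^ ((2 : ℝ) / 3)) =
      (3 / (4 * √2)) • ∫ E in Set.Ioi (0 : ℝ),
        (2 * √(2 * E)) • displacementEnergyKernel t₁ t₂ (2 * √(2 * E) * u) E := by
  rw [← integral_comp_rpow_Ioi _ (show (3 / 2 : ℝ) ≠ 0 by norm_num), ← integral_smul]
  refine setIntegral_congr_fun measurableSet_Ioi fun E hE ↦ ?_
  have hE0 : 0 ≤ E := (Set.mem_Ioi.1 hE).le
  have h₁ : (E ^ (3 / 2 : ℝ)) ^ ((1 : ℝ) / 3) = √E := by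
    rw [← Real.rpow_mul hE0, Real.sqrt_eq_rpow]
    norm_num
  have h₂ : (E ^ (3 / 2 : ℝ)) ^ ((2 : ℝ) / 3) = E := by
    rw [← Real.rpow_mul hE0]
    norm_num
  have h₃ : E ^ (3 / 2 - 1 : ℝ) = √E := by
    rw [Real.sqrt_eq_rpow]
    norm_num
  have h₄ : √(2 * E) = √2 * √E := Real.sqrt_mul zero_le_two E
  rw [h₁, h₂, h₃, h₄, smul_smul]
  congr 1
  · rw [abs_of_pos (by norm_num)]
    field_simp
    ring
  · congr 1
    ring

/-- The joint characteristic function of `(p + √(p² + 2q), q + p²/2)` for `q ~ Exp(1)` and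
`p ~ N(0,1)` independent equals the joint characteristic function of
`(2√2 * q * p^(1/3), p^(2/3))` for `q` uniform on `[0,1]` and `p` with density
`(2/(3√π)) * exp (-p^(2/3))` doubled on `[0, ∞)`. -/
theorem expBinaryHMC_charFun_eq (t₁ t₂ : ℝ) :
    (1 / Real.sqrt (2 * Real.pi)) •
        ∫ q in Set.Ioi (0 : ℝ), ∫ p : ℝ,
          Complex.exp (Complex.I * (t₁ : ℂ) * ((p + Real.sqrt (p ^ 2 + 2 * q) : ℝ) : ℂ) +
              Complex.I * (t₂ : ℂ) * ((q + p ^ 2 / 2 : ℝ) : ℂ)) *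
            (Real.exp (-q) : ℂ) * (Real.exp (-(p ^ 2 / 2)) : ℂ) =
      (4 / (3 * Real.sqrt Real.pi)) •
        ∫ q in Set.Ioc (0 : ℝ) 1, ∫ p in Set.Ioi (0 : ℝ),
          Complex.exp (Complex.I * (t₁ : ℂ) * ((2 * Real.sqrt 2 * q * p ^ ((1 : ℝ) / 3) : ℝ) : ℂ) +
              Complex.I * (t₂ : ℂ) * ((p ^ ((2 : ℝ) / 3) : ℝ) : ℂ)) *
            (Real.exp (-(p ^ ((2 : ℝ) / 3))) : ℂ) := by
  have hl (q p : ℝ) :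
      Complex.exp (Complex.I * (t₁ : ℂ) * ((p + Real.sqrt (p ^ 2 + 2 * q) : ℝ) : ℂ) +
          Complex.I * (t₂ : ℂ) * ((q + p ^ 2 / 2 : ℝ) : ℂ)) *
        (Real.exp (-q) : ℂ) * (Real.exp (-(p ^ 2 / 2)) : ℂ) =
      displacementEnergyKernel t₁ t₂ (p + √(p ^ 2 + 2 * q)) (q + p ^ 2 / 2) := by
    rw [displacementEnergyKernel, mul_assoc, ← Complex.ofReal_mul, ← Real.exp_add, neg_add]
  have hr (q : ℝ) := integral_comp_rpow_displacementEnergyKernel t₁ t₂ q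
  simp only [displacementEnergyKernel] at hr
  simp only [hl, hr]
  rw [integral_exp_gaussian_eq, integral_smul, smul_smul]
  simp only [displacementEnergyKernel]
  congr 1
  rw [Real.sqrt_mul zero_le_two]
  field_simp
end
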